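/- arXiv:2507.08646 — 3 statements merged into one kernel-verified Lean document; each statement's English description precedes it below -/
import Mathlib

section
/- For every integer h ≥ 1 and every integer i0 with 0 ≤ i0 ≤ h−1, there exists a set A of integers with |A| = 4 such that |hA| = C(h+3, 3) − C(i0+2, 3). In other words, {C(h+3,3) − C(i0+2,3) : 0 ≤ i0 ≤ h−1} ⊆ R_Z(h, 4), where R_Z(h, k) = { |hA| : A ⊆ ℤ, |A| = k }. -/
open Pointwise

/-- The `h`-fold sumset of a finite set of integers: `hsum 0 A = {0}`,
`hsum (n+1) A = A + hsum n A`. -/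
def hsum : ℕ → Finset ℤ → Finset ℤ
  | 0, _ => {0}
  | n + 1, A => A + hsum n A

/-- `RZ h k` is the set of `h`-fold sumset sizes of `k`-element sets of integers. -/
def RZ (h k : ℕ) : Set ℕ :=
  {n : ℕ | ∃ A : Finset ℤ, A.card = k ∧ (hsum h A).card = n}

/-- A partial hockey-stick identity. -/
theorem sum_range_choose_add_choose (n k m : ℕ) (hm : m ≤ n + 1) :
    ∑ x ∈ Finset.range m, (n - x + k).choose k + (n + k + 1 - m).choose (k + 1) =
      (n + k + 1).choose (k + 1) := by
  induction m with
  | zero => simp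
  | succ m ih =>
    rw [Finset.sum_range_succ, ← ih (by omega), show n + k + 1 - m = n - m + k + 1 by omega,
      show n + k + 1 - (m + 1) = n - m + k by omega, Nat.choose_succ_succ, add_assoc]

/-- Triples `(x, y, z)` of natural numbers with `x < d` and `x + y + z ≤ h`. -/
def boundedTriples (d h : ℕ) : Finset (Σ _ : ℕ, Σ _ : ℕ, ℕ) :=
  (Finset.range d).sigma fun x => (Finset.range (h - x + 1)).sigma fun y =>
    Finset.range (h - x - y + 1)

theorem card_boundedTriples (d h : ℕ) (hd : d ≤ h + 1) :
    (boundedTriples d h).card = (h + 3).choose 3 - (h + 3 - d).choose 3 := by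
  have inner (n : ℕ) : ∑ y ∈ Finset.range (n + 1), (n - y + 1) = (n + 2).choose 2 := by
    simpa using sum_range_choose_add_choose n 1 (n + 1) le_rfl
  simp only [boundedTriples, Finset.card_sigma, Finset.card_range, inner]
  have outer := sum_range_choose_add_choose h 2 d hd
  simp only [Nat.reduceAdd, add_assoc] at outer
  omega

/-- Every element of the `h`-fold sumset of `{0, 1, d, M}` uses the summand `1` fewer than
`d` times in some representation. -/
theorem mem_hsum_iff (d M : ℕ) (hd : 2 ≤ d) (h : ℕ) (n : ℤ) :
    n ∈ hsum h {0, 1, (d : ℤ), (M : ℤ)} ↔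
      ∃ x y z : ℕ, x < d ∧ x + y + z ≤ h ∧ (x + d * y + M * z : ℤ) = n := by
  induction h generalizing n with
  | zero =>
    simp only [hsum, Finset.mem_singleton]
    constructor
    · rintro rfl
      exact ⟨0, 0, 0, by omega, by omega, by simp⟩
    · rintro ⟨x, y, z, -, hs, rfl⟩
      obtain ⟨rfl, rfl, rfl⟩ : x = 0 ∧ y = 0 ∧ z = 0 := by omega
      simp
  | succ h ih =>
    simp only [hsum, Finset.mem_add, ih, Finset.mem_insert, Finset.mem_singleton]
    constructor
    · rintro ⟨a, ha, _, ⟨x, y, z, hx, hs, rfl⟩, rfl⟩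
      rcases ha with rfl | rfl | rfl | rfl
      · exact ⟨x, y, z, hx, by omega, by ring⟩
      · rcases Nat.lt_or_ge (x + 1) d with hlt | hge
        · exact ⟨x + 1, y, z, hlt, by omega, by push_cast; ring⟩
        · obtain rfl : d = x + 1 := by omega
          exact ⟨0, y + 1, z, by omega, by omega, by push_cast; ring⟩
      · exact ⟨x, y + 1, z, hx, by omega, by push_cast; ring⟩
      · exact ⟨x, y, z + 1, hx, by omega, by push_cast; ring⟩
    · rintro ⟨x, y, z, hx, hs, rfl⟩
      rcases x with _ | x
      · rcases y with _ | y
        · rcases z with _ | z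
          · exact ⟨0, by simp, _, ⟨0, 0, 0, hx, by omega, rfl⟩, by simp⟩
          · exact ⟨M, by simp, _, ⟨0, 0, z, hx, by omega, rfl⟩, by push_cast; ring⟩
        · exact ⟨d, by simp, _, ⟨0, y, z, hx, by omega, rfl⟩, by push_cast; ring⟩
      · exact ⟨1, by simp, _, ⟨x, y, z, by omega, by omega, rfl⟩, by push_cast; ring⟩

theorem card_hsum (d h : ℕ) (hd : 2 ≤ d) (hdh : d ≤ h + 1) :
    (hsum h {0, 1, (d : ℤ), ((d * h + d : ℕ) : ℤ)}).card =
      (h + 3).choose 3 - (h + 3 - d).choose 3 := by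
  rw [← card_boundedTriples d h hdh]
  symm
  refine Finset.card_bij
    (fun t _ => (t.1 + d * t.2.1 + (d * h + d : ℕ) * t.2.2 : ℤ)) ?_ ?_ ?_
  · rintro ⟨x, y, z⟩ ht
    simp only [boundedTriples, Finset.mem_sigma, Finset.mem_range] at ht
    exact (mem_hsum_iff d _ hd h _).2 ⟨x, y, z, ht.1, by omega, rfl⟩
  · rintro ⟨x, y, z⟩ ht ⟨x', y', z'⟩ ht' heq
    simp only [boundedTriples, Finset.mem_sigma, Finset.mem_range] at ht ht'
    have key : x + d * (y + (h + 1) * z) = x' + d * (y' + (h + 1) * z') := by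
      zify
      push_cast at heq
      linear_combination heq
    have hx : x = x' := by
      have := congrArg (· % d) key
      simpa [Nat.mod_eq_of_lt ht.1, Nat.mod_eq_of_lt ht'.1] using this
    subst hx
    have key' : y + (h + 1) * z = y' + (h + 1) * z' :=
      Nat.eq_of_mul_eq_mul_left (by omega) (Nat.add_left_cancel key)
    have hy : y = y' := by
      have := congrArg (· % (h + 1)) key'
      simpa [Nat.mod_eq_of_lt (show y < h + 1 by omega),
        Nat.mod_eq_of_lt (show y' < h + 1 by omega)] using this
    subst hy
    have hz : z = z' := Nat.eq_of_mul_eq_mul_left (by omega) (Nat.add_left_cancel key')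
    rw [hz]
  · intro n hn
    obtain ⟨x, y, z, hx, hs, hn⟩ := (mem_hsum_iff d _ hd h n).1 hn
    refine ⟨⟨x, y, z⟩, ?_, hn⟩
    simp only [boundedTriples, Finset.mem_sigma, Finset.mem_range]
    omega

theorem stmt_1 (h : ℕ) (hh : 1 ≤ h) :
    (∀ i0 : ℕ, i0 ≤ h - 1 →
      ∃ A : Finset ℤ, A.card = 4 ∧
        (hsum h A).card = Nat.choose (h + 3) 3 - Nat.choose (i0 + 2) 3) ∧
    {n : ℕ | ∃ i0 : ℕ, i0 ≤ h - 1 ∧ n = Nat.choose (h + 3) 3 - Nat.choose (i0 + 2) 3}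
      ⊆ RZ h 4 := by
  have exists_set (i0 : ℕ) (hi : i0 ≤ h - 1) : ∃ A : Finset ℤ, A.card = 4 ∧
      (hsum h A).card = Nat.choose (h + 3) 3 - Nat.choose (i0 + 2) 3 := by
    obtain ⟨d, hd⟩ : ∃ d, d + i0 = h + 1 := ⟨h + 1 - i0, by omega⟩
    refine ⟨{0, 1, (d : ℤ), ((d * h + d : ℕ) : ℤ)}, ?_, ?_⟩
    · have hpos : 0 < d * h := Nat.mul_pos (by omega) hh
      generalize d * h = m at hpos ⊢
      rw [Finset.card_insert_of_notMem, Finset.card_insert_of_notMem, Finset.card_pair] <;>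
        (try simp only [Finset.mem_insert, Finset.mem_singleton]) <;> omega
    · rw [card_hsum d h (by omega) (by omega), show h + 3 - d = i0 + 2 by omega]
  refine ⟨exists_set, ?_⟩
  rintro n ⟨i0, hi, rfl⟩
  exact exists_set i0 hi
end

section
/- Let h ≥ 2 be an integer, let i0 be an integer with 1 ≤ i0 ≤ h−1, let c = (h+1−i0)(h+1), let B = {0, 1, h+1} ⊆ ℤ, and for 0 ≤ i ≤ h let L_i = (h−i)B + ic. Then for every i with 0 ≤ i ≤ h, L_i = ⋃_{j=0}^{h−i} M_{i,j}, where M_{i,j} = (h + (h−i0)i − j)(h+1) + [0, j] and [0, j] denotes the integer interval {0, 1, …, j}. Moreover, for fixed i the intervals M_{i,j}, 0 ≤ j ≤ h−i, are pairwise disjoint. -/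
open Pointwise

/-- The `n`-fold sumset of `{0, 1, q}` consists of the sums `a + b * q` with `a + b ≤ n`. -/
theorem mem_hsum_zero_one_iff (q : ℤ) (n : ℕ) (x : ℤ) :
    x ∈ hsum n {0, 1, q} ↔ ∃ a b : ℕ, a + b ≤ n ∧ x = a + b * q := by
  induction n generalizing x with
  | zero =>
    simp only [hsum, Finset.mem_singleton]
    constructor
    · rintro rfl
      exact ⟨0, 0, by simp⟩
    · rintro ⟨a, b, hab, rfl⟩
      obtain ⟨rfl, rfl⟩ : a = 0 ∧ b = 0 := by omega
      simp
  | succ n ih =>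
    simp only [hsum, Finset.mem_add, ih, Finset.mem_insert, Finset.mem_singleton]
    constructor
    · rintro ⟨y, hy, z, ⟨a, b, hab, rfl⟩, rfl⟩
      rcases hy with rfl | rfl | rfl
      · exact ⟨a, b, by omega, by ring⟩
      · exact ⟨a + 1, b, by omega, by push_cast; ring⟩
      · exact ⟨a, b + 1, by omega, by push_cast; ring⟩
    · rintro ⟨a, b, hab, rfl⟩
      rcases a with _ | a
      · rcases b with _ | b
        · exact ⟨0, by simp, 0, ⟨0, 0, by simp⟩, by simp⟩
        · exact ⟨q, by simp, b * q, ⟨0, b, by omega, by simp⟩, by push_cast; ring⟩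
      · exact ⟨1, by simp, a + b * q, ⟨a, b, by omega, rfl⟩, by push_cast; ring⟩

/-- Intervals of length less than `q` starting at different multiples of `q` are disjoint. -/
theorem disjoint_Icc_mul {q u v s t : ℤ} (hs : s < q) (ht : t < q) (huv : u ≠ v) :
    Disjoint (Finset.Icc (u * q) (u * q + s)) (Finset.Icc (v * q) (v * q + t)) := by
  rw [Finset.disjoint_left]
  intro x hx hy
  rw [Finset.mem_Icc] at hx hy
  have hq : 0 < q := by linarith
  rcases lt_or_gt_of_ne huv with huv | huv <;> nlinarith

theorem stmt_10 (h : ℕ) (hh : 2 ≤ h) (i0 : ℕ) (hi0l : 1 ≤ i0) (hi0u : i0 ≤ h - 1)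
    (c : ℤ) (hc : c = ((h : ℤ) + 1 - (i0 : ℤ)) * ((h : ℤ) + 1))
    (B : Finset ℤ) (hB : B = {0, 1, (h : ℤ) + 1})
    (L : ℕ → Finset ℤ)
    (hL : ∀ i, L i = (hsum (h - i) B).image (fun x => x + (i : ℤ) * c))
    (M : ℕ → ℕ → Finset ℤ)
    (hM : ∀ i j, M i j =
      Finset.Icc (((h : ℤ) + ((h : ℤ) - (i0 : ℤ)) * (i : ℤ) - (j : ℤ)) * ((h : ℤ) + 1))
        (((h : ℤ) + ((h : ℤ) - (i0 : ℤ)) * (i : ℤ) - (j : ℤ)) * ((h : ℤ) + 1) + (j : ℤ))) :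
    ∀ i : ℕ, i ≤ h →
      L i = (Finset.range (h - i + 1)).biUnion (M i) ∧
      ∀ j j' : ℕ, j ≤ h - i → j' ≤ h - i → j ≠ j' → Disjoint (M i j) (M i j') := by
  intro i hi
  subst hc hB
  refine ⟨?_, fun j j' hj hj' hne => ?_⟩
  · ext x
    simp only [hL, hM, Finset.mem_image, Finset.mem_biUnion, Finset.mem_range, Finset.mem_Icc,
      mem_hsum_zero_one_iff]
    constructor
    · rintro ⟨_, ⟨a, b, hab, rfl⟩, rfl⟩
      obtain ⟨k, rfl⟩ : ∃ k, h = i + b + k := ⟨h - i - b, by omega⟩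
      have hak : (a : ℤ) ≤ k := by omega
      refine ⟨k, by omega, ?_, ?_⟩ <;> push_cast <;> nlinarith
    · rintro ⟨j, hj, hlow, hupp⟩
      obtain ⟨b, rfl⟩ : ∃ b, h = i + b + j := ⟨h - i - j, by omega⟩
      obtain ⟨a, ha⟩ := Int.eq_ofNat_of_zero_le (sub_nonneg.mpr hlow)
      refine ⟨_, ⟨a, b, by omega, rfl⟩, ?_⟩
      rw [← ha]
      push_cast
      ring
  · rw [hM, hM]
    exact disjoint_Icc_mul (by omega) (by omega) (by omega)
end

section
/- Let h ≥ 2 be an integer, let i0 be an integer with 1 ≤ i0 ≤ h−1, let c = (h+1−i0)(h+1), let B = {0, 1, h+1} ⊆ ℤ, and for 0 ≤ i ≤ h let L_i = (h−i)B + ic. Then for every integer i with 0 ≤ i ≤ i0, |L_i ∩ L_{i+1}| = C(i0+1−i, 2). -/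
open Pointwise

theorem mem_hsum_zero_one (g : ℤ) (n : ℕ) (x : ℤ) :
    x ∈ hsum n {0, 1, g} ↔ ∃ a b : ℕ, a + b ≤ n ∧ x = a + b * g := by
  induction n generalizing x with
  | zero =>
    simp only [hsum, Finset.mem_singleton]
    constructor
    · rintro rfl
      exact ⟨0, 0, by simp, by simp⟩
    · rintro ⟨a, b, hab, rfl⟩
      obtain ⟨rfl, rfl⟩ : a = 0 ∧ b = 0 := by omega
      simp
  | succ n ih =>
    simp only [hsum, Finset.mem_add, ih, Finset.mem_insert, Finset.mem_singleton]
    constructor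
    · rintro ⟨y, hy, z, ⟨a, b, hab, rfl⟩, rfl⟩
      rcases hy with rfl | rfl | rfl
      · exact ⟨a, b, by omega, by ring⟩
      · exact ⟨a + 1, b, by omega, by push_cast; ring⟩
      · exact ⟨a, b + 1, by omega, by push_cast; ring⟩
    · rintro ⟨a, b, hab, rfl⟩
      rcases a with _ | a
      · rcases b with _ | b
        · exact ⟨0, by simp, 0, ⟨0, 0, by omega, by simp⟩, by simp⟩
        · exact ⟨g, by simp, b * g, ⟨0, b, by omega, by simp⟩, by push_cast; ring⟩
      · exact ⟨1, by simp, a + b * g, ⟨a, b, by omega, rfl⟩, by push_cast; ring⟩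

/-- Uniqueness of division with remainder, for quotients written as arbitrary integers. -/
theorem eq_and_eq_of_add_mul_eq {g a a' b b' : ℤ} (ha : 0 ≤ a) (hag : a < g) (ha' : 0 ≤ a')
    (hag' : a' < g) (e : a + b * g = a' + b' * g) : a = a' ∧ b = b' := by
  have key : a = a' := by
    have := congrArg (· % g) e
    simpa [Int.emod_eq_of_lt ha hag, Int.emod_eq_of_lt ha' hag'] using this
  subst key
  exact ⟨rfl, mul_right_cancel₀ (by omega : g ≠ 0) (add_left_cancel e)⟩

theorem card_sigma_range_antidiagonal (m : ℕ) :
    ((Finset.range m).sigma fun s => Finset.HasAntidiagonal.antidiagonal s).card = (m + 1).choose 2 := by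
  rw [Finset.card_sigma]
  induction m with
  | zero => simp
  | succ m ih =>
    rw [Finset.sum_range_succ, ih, Finset.Nat.card_antidiagonal, Nat.choose_succ_succ' (m + 1) 1,
      Nat.choose_one_right, add_comm]

theorem stmt_16 (h : ℕ) (hh : 2 ≤ h) (i0 : ℕ) (hi0l : 1 ≤ i0) (hi0u : i0 ≤ h - 1)
    (c : ℤ) (hc : c = ((h : ℤ) + 1 - (i0 : ℤ)) * ((h : ℤ) + 1))
    (B : Finset ℤ) (hB : B = {0, 1, (h : ℤ) + 1})
    (L : ℕ → Finset ℤ)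
    (hL : ∀ i, L i = (hsum (h - i) B).image (fun x => x + (i : ℤ) * c)) :
    ∀ i : ℕ, i ≤ i0 → (L i ∩ L (i + 1)).card = Nat.choose (i0 + 1 - i) 2 := by
  intro i hi
  have hm : i0 + 1 - i = (i0 - i) + 1 := by omega
  rw [hm, ← card_sigma_range_antidiagonal]
  symm
  refine Finset.card_bij
    (fun p _ => (p.2.1 : ℤ) + p.2.2 * ((h : ℤ) + 1) + ((i + 1 : ℕ) : ℤ) * c) ?_ ?_ ?_
  · rintro ⟨s, a, b⟩ hp
    simp only [Finset.mem_sigma, Finset.mem_range,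
      Finset.HasAntidiagonal.mem_antidiagonal] at hp
    simp only [Finset.mem_inter, hL, hB, Finset.mem_image, mem_hsum_zero_one]
    refine ⟨⟨_, ⟨a, b + (h + 1 - i0), by omega, rfl⟩, ?_⟩, ⟨_, ⟨a, b, by omega, rfl⟩, rfl⟩⟩
    rw [hc]
    push_cast [Nat.cast_sub (show i0 ≤ h + 1 by omega)]
    ring
  · rintro ⟨s, a, b⟩ hp ⟨s', a', b'⟩ hp' e
    simp only [Finset.mem_sigma, Finset.mem_range,
      Finset.HasAntidiagonal.mem_antidiagonal] at hp hp'
    dsimp only at e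
    obtain ⟨h1, h2⟩ := eq_and_eq_of_add_mul_eq (by omega) (by omega) (by omega) (by omega)
      (add_right_cancel e)
    obtain rfl : a = a' := by exact_mod_cast h1
    obtain rfl : b = b' := by exact_mod_cast h2
    obtain rfl : s = s' := by omega
    rfl
  · intro x hx
    simp only [Finset.mem_inter, hL, hB, Finset.mem_image, mem_hsum_zero_one] at hx
    obtain ⟨⟨_, ⟨a, b, hab, rfl⟩, rfl⟩, ⟨_, ⟨a', b', hab', rfl⟩, e⟩⟩ := hx
    have e' : (a : ℤ) + b * ((h : ℤ) + 1) =
        a' + ((b' : ℤ) + ((h : ℤ) + 1 - i0)) * ((h : ℤ) + 1) := by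
      rw [hc] at e
      push_cast at e
      linear_combination -e
    obtain ⟨h1, h2⟩ := eq_and_eq_of_add_mul_eq (by omega) (by omega) (by omega) (by omega) e'
    refine ⟨⟨a' + b', a', b'⟩, ?_, e⟩
    simp only [Finset.mem_sigma, Finset.mem_range,
      Finset.HasAntidiagonal.mem_antidiagonal, and_true]
    omega
end
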